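/- Let G be a finite simple graph on n ≥ 2 vertices with maximum degree Δ ≥ 1, let P be its lazy random-walk matrix, and let λ₂ be the second largest eigenvalue of P (eigenvalues listed in nonincreasing order with multiplicities). If 0 ≤ λ₂ < 1, then (1 − λ₂)·Δ ≤ h(G) ≤ √(8·(1 − λ₂))·Δ. -/

import Mathlib

open scoped Classical

noncomputable section

/-- The number of edges of `G` leaving the set `S`, counted as ordered pairs
`(u, v)` with `u ∈ S`, `v ∉ S` and `u ~ v` (each cut edge is counted once). -/
def cutCard {V : Type*} [Fintype V] (G : SimpleGraph V) (S : Set V) : ℕ :=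
  {p : V × V | p.1 ∈ S ∧ p.2 ∉ S ∧ G.Adj p.1 p.2}.ncard

/-- The edge expansion `h(G)` of a finite graph: the infimum of `|δ(S)|/|S|`
over all nonempty `S` with `|S| ≤ |V|/2`. -/
noncomputable def edgeExpansion {V : Type*} [Fintype V] (G : SimpleGraph V) : ℝ :=
  sInf { r : ℝ | ∃ S : Set V, S.Nonempty ∧ 2 * S.ncard ≤ Fintype.card V ∧
    r = (cutCard G S : ℝ) / (S.ncard : ℝ) }
/-- The lazy random-walk matrix of a graph `G` with maximum degree `Δ`:
`p_{vw} = 1/(2Δ)` for an edge `{v,w}`, `p_{vv} = 1/2 + (Δ - deg v)/(2Δ)`,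
and `p_{vw} = 0` otherwise. -/
def lazyWalkMatrix {V : Type*} [Fintype V] [DecidableEq V] (G : SimpleGraph V)
    [DecidableRel G.Adj] : Matrix V V ℝ :=
  Matrix.of fun v w =>
    if G.Adj v w then 1 / (2 * (G.maxDegree : ℝ))
    else if v = w then
      1 / 2 + ((G.maxDegree : ℝ) - (G.degree v : ℝ)) / (2 * (G.maxDegree : ℝ))
    else 0

section Spectral

open Matrix

variable {V : Type*} [Fintype V] {A : Matrix V V ℝ}

theorem Matrix.IsHermitian.exists_eigenbasis_of_charpoly_eq [DecidableEq V] (hA : A.IsHermitian)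
    {μ : Fin (Fintype.card V) → ℝ} (hanti : Antitone μ)
    (hchar : A.charpoly = ∏ i, (Polynomial.X - Polynomial.C (μ i))) :
    ∃ b : OrthonormalBasis (Fin (Fintype.card V)) ℝ (EuclideanSpace ℝ V),
      ∀ i, A *ᵥ (b i).ofLp = μ i • (b i).ofLp := by
  have hμ : hA.eigenvalues₀ = μ := by
    rw [← List.ofFn_inj, ← hA.sort_roots_charpoly_eq_eigenvalues₀, hchar, Polynomial.roots_prod]
    · simp only [Polynomial.roots_X_sub_C, Multiset.bind_singleton, Fin.univ_val_map,
        Multiset.map_coe, Multiset.coe_sort, List.map_ofFn, Function.comp_def, RCLike.re_to_real]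
      apply List.mergeSort_of_pairwise
      simp_rw [decide_eq_true_eq, ← List.sortedGE_iff_pairwise]
      exact hanti.sortedGE_ofFn
    · simp [Finset.prod_ne_zero_iff, Polynomial.X_sub_C_ne_zero]
  refine ⟨hA.eigenvectorBasis.reindex (Fintype.equivOfCardEq (Fintype.card_fin _)).symm,
    fun i => ?_⟩
  have h := hA.mulVec_eigenvectorBasis (Fintype.equivOfCardEq (Fintype.card_fin _) i)
  simp only [Matrix.IsHermitian.eigenvalues, hμ, Equiv.symm_apply_apply] at h
  simpa [OrthonormalBasis.reindex_apply] using h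

theorem Matrix.IsHermitian.dotProduct_mulVec_comm (hA : A.IsHermitian) (x y : V → ℝ) :
    x ⬝ᵥ A *ᵥ y = A *ᵥ x ⬝ᵥ y := by
  rw [dotProduct_mulVec, ← mulVec_transpose]
  congr 2

theorem Matrix.IsHermitian.dotProduct_eq_zero_of_eigenvalue_ne (hA : A.IsHermitian)
    {x y : V → ℝ} {a b : ℝ} (hx : A *ᵥ x = a • x) (hy : A *ᵥ y = b • y) (hab : a ≠ b) :
    x ⬝ᵥ y = 0 := by
  have h := hA.dotProduct_mulVec_comm x y
  rw [hx, hy, dotProduct_smul, smul_dotProduct, smul_eq_mul, smul_eq_mul] at h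
  exact (mul_eq_zero.mp (show (a - b) * (x ⬝ᵥ y) = 0 by linarith)).resolve_left
    (sub_ne_zero.mpr hab)

/-- If `z` is an eigenvector whose eigenvalue exceeds the second largest eigenvalue, then the
second largest eigenvalue bounds the Rayleigh quotient on the orthogonal complement of `z`. -/
theorem Matrix.IsHermitian.dotProduct_mulVec_le_of_orthogonal (hA : A.IsHermitian)
    {ι : Type*} [Fintype ι] {μ : ι → ℝ} (b : OrthonormalBasis ι ℝ (EuclideanSpace ℝ V))
    (hb : ∀ i, A *ᵥ (b i).ofLp = μ i • (b i).ofLp) {i₀ : ι} {m c : ℝ}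
    (hm : ∀ i ≠ i₀, μ i ≤ m) {z : V → ℝ} (hz0 : z ≠ 0) (hz : A *ᵥ z = c • z) (hc : m < c)
    {x : V → ℝ} (hx : x ⬝ᵥ z = 0) : x ⬝ᵥ A *ᵥ x ≤ m * (x ⬝ᵥ x) := by
  have parseval (u v : V → ℝ) : ∑ i, (u ⬝ᵥ (b i).ofLp) * (v ⬝ᵥ (b i).ofLp) = u ⬝ᵥ v := by
    have h := b.sum_inner_mul_inner (WithLp.toLp 2 u) (WithLp.toLp 2 v)
    simpa [EuclideanSpace.inner_eq_star_dotProduct, dotProduct_comm] using h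
  have hzb (i : ι) (hi : i ≠ i₀) : z ⬝ᵥ (b i).ofLp = 0 :=
    hA.dotProduct_eq_zero_of_eigenvalue_ne hz (hb i) ((hm i hi).trans_lt hc).ne'
  have single (u : V → ℝ) : (u ⬝ᵥ (b i₀).ofLp) * (z ⬝ᵥ (b i₀).ofLp) = u ⬝ᵥ z := by
    rw [← parseval u z]
    symm
    apply Fintype.sum_eq_single
    intro i hi
    rw [hzb i hi, mul_zero]
  have hz₀ : z ⬝ᵥ (b i₀).ofLp ≠ 0 := fun h => hz0 <| by
    simpa [h] using (single z).symm
  have hx₀ : x ⬝ᵥ (b i₀).ofLp = 0 :=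
    (mul_eq_zero.mp ((single x).trans hx)).resolve_right hz₀
  rw [← parseval x (A *ᵥ x), ← parseval x x, Finset.mul_sum]
  refine Finset.sum_le_sum fun i _ => ?_
  rw [← hA.dotProduct_mulVec_comm, hb, dotProduct_smul, smul_eq_mul]
  rcases eq_or_ne i i₀ with rfl | hi
  · simp [hx₀]
  · nlinarith [mul_le_mul_of_nonneg_right (hm i hi) (mul_self_nonneg (x ⬝ᵥ (b i).ofLp))]

end Spectral

section Expansion

open Matrix

theorem adjMatrix_nonneg {V : Type*} (G : SimpleGraph V) [DecidableRel G.Adj] (u v : V) :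
    0 ≤ G.adjMatrix ℝ u v := by
  rw [SimpleGraph.adjMatrix_apply]
  split_ifs <;> norm_num

variable {V : Type*} [Fintype V] (G : SimpleGraph V)

theorem edgeExpansion_le (S : Set V) (hS : S.Nonempty) (hcard : 2 * S.ncard ≤ Fintype.card V) :
    edgeExpansion G ≤ (cutCard G S : ℝ) / (S.ncard : ℝ) :=
  csInf_le ⟨0, by rintro r ⟨T, -, -, rfl⟩; positivity⟩ ⟨S, hS, hcard, rfl⟩

theorem edgeExpansion_nonneg : 0 ≤ edgeExpansion G :=
  Real.sInf_nonneg (by rintro r ⟨T, -, -, rfl⟩; positivity)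

variable [DecidableRel G.Adj]

theorem cutCard_eq_sum (S : Set V) :
    (cutCard G S : ℝ) = ∑ u, ∑ v, G.adjMatrix ℝ u v * (if u ∈ S ∧ v ∉ S then 1 else 0) := by
  rw [cutCard, Set.ncard_eq_toFinset_card', Finset.card_eq_sum_ones, Nat.cast_sum,
    Set.toFinset_ofPred, Finset.sum_filter, Fintype.sum_prod_type]
  refine Finset.sum_congr rfl fun u _ => Finset.sum_congr rfl fun v _ => ?_
  by_cases h1 : u ∈ S <;> by_cases h2 : v ∈ S <;> by_cases h3 : G.Adj u v <;>
    simp [h1, h2, h3, SimpleGraph.adjMatrix_apply]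

theorem sum_adjMatrix_apply (u : V) : ∑ v, G.adjMatrix ℝ u v = G.degree u := by
  simp only [SimpleGraph.adjMatrix_apply, Finset.sum_boole]
  rw [← SimpleGraph.card_neighborFinset_eq_degree, SimpleGraph.neighborFinset_eq_filter]

theorem sum_adjMatrix_mul_comm (F : V → V → ℝ) :
    ∑ u, ∑ v, G.adjMatrix ℝ u v * F u v = ∑ u, ∑ v, G.adjMatrix ℝ u v * F v u := by
  rw [Finset.sum_comm]
  simp only [SimpleGraph.adjMatrix_apply, G.adj_comm]

theorem sum_adjMatrix_mul_left (F : V → ℝ) :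
    ∑ u, ∑ v, G.adjMatrix ℝ u v * F u = ∑ u, (G.degree u : ℝ) * F u := by
  refine Finset.sum_congr rfl fun u _ => ?_
  rw [← Finset.sum_mul, sum_adjMatrix_apply]

theorem sum_adjMatrix_mul_le {F F' : V → V → ℝ} (h : ∀ u v, F u v ≤ F' u v) :
    ∑ u, ∑ v, G.adjMatrix ℝ u v * F u v ≤ ∑ u, ∑ v, G.adjMatrix ℝ u v * F' u v := by
  exact Finset.sum_le_sum fun u _ => Finset.sum_le_sum fun v _ =>
    mul_le_mul_of_nonneg_left (h u v) (adjMatrix_nonneg G u v)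

/-- A discrete co-area inequality. -/
theorem edgeExpansion_mul_sum_le (w : V → ℝ) (hw : 0 ≤ w)
    (hcard : 2 * {v | 0 < w v}.ncard ≤ Fintype.card V) :
    edgeExpansion G * ∑ v, w v ≤ ∑ u, ∑ v, G.adjMatrix ℝ u v * max (w u - w v) 0 := by
  induction hk : {v | 0 < w v}.ncard using Nat.strong_induction_on generalizing w with
  | _ k ih =>
  subst hk
  set S : Set V := {v | 0 < w v}
  have hout (v : V) (hv : v ∉ S) : w v = 0 := le_antisymm (not_lt.mp hv) (hw v)
  rcases S.eq_empty_or_nonempty with hS | hS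
  · have h0 : w = 0 := funext fun v => hout v (by simp [hS])
    simp [h0]
  obtain ⟨v₀, hv₀, hmin⟩ := S.toFinite.exists_minimalFor w S hS
  replace hmin (v : V) (hv : v ∈ S) : w v₀ ≤ w v := by
    rcases le_total (w v₀) (w v) with h | h
    · exact h
    · exact hmin hv h
  let w' : V → ℝ := fun v => if v ∈ S then w v - w v₀ else 0
  have hw' : 0 ≤ w' := fun v => by
    by_cases hv : v ∈ S
    · simpa [w', hv] using hmin v hv
    · simp [w', hv]
  have hlt : {v | 0 < w' v}.ncard < S.ncard := by
    refine Set.ncard_lt_ncard ⟨fun v hv => ?_, fun h => ?_⟩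
    · by_contra hvS
      simp [w', hvS] at hv
    · have := h hv₀
      simp [w', hv₀] at this
  have hind := ih _ hlt w' hw' (by omega) rfl
  have hsum : ∑ v, w v = w v₀ * S.ncard + ∑ v, w' v := by
    have h1 : (S.ncard : ℝ) = ∑ v, if v ∈ S then 1 else 0 := by
      rw [Set.ncard_eq_toFinset_card']
      simp
    rw [h1, Finset.mul_sum, ← Finset.sum_add_distrib]
    refine Finset.sum_congr rfl fun v _ => ?_
    by_cases hv : v ∈ S
    · simp [w', hv]
    · simp [w', hv, hout v hv]
  have hcut : ∑ u, ∑ v, G.adjMatrix ℝ u v * max (w u - w v) 0 =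
      w v₀ * cutCard G S + ∑ u, ∑ v, G.adjMatrix ℝ u v * max (w' u - w' v) 0 := by
    rw [cutCard_eq_sum]
    simp only [Finset.mul_sum, ← Finset.sum_add_distrib]
    refine Finset.sum_congr rfl fun u _ => Finset.sum_congr rfl fun v _ => ?_
    rw [mul_left_comm, ← mul_add]
    congr 1
    by_cases hu : u ∈ S <;> by_cases hv : v ∈ S
    · simp [w', hu, hv]
    · simp [w', hu, hv, hout v hv, show 0 ≤ w u from hw u, hmin u hu]
    · simp [w', hu, hv, hout u hu, show 0 ≤ w v from hw v, hmin v hv]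
    · simp [w', hu, hv, hout u hu, hout v hv]
  have hpos : (0 : ℝ) < S.ncard := by
    exact_mod_cast (Set.ncard_pos).mpr hS
  have hh := (le_div_iff₀ hpos).mp (edgeExpansion_le G S hS hcard)
  rw [hsum, hcut]
  nlinarith [mul_le_mul_of_nonneg_left hh (hw v₀)]

theorem edgeExpansion_mul_sum_sq_le (g : V → ℝ)
    (hcard : 2 * {v | g v ≠ 0}.ncard ≤ Fintype.card V) :
    (edgeExpansion G * ∑ v, g v ^ 2) ^ 2 ≤
      (G.maxDegree * ∑ v, g v ^ 2) * ∑ u, ∑ v, G.adjMatrix ℝ u v * (g u - g v) ^ 2 := by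
  have hset : {v | 0 < g v ^ 2} = {v | g v ≠ 0} := by ext v; simp [sq_pos_iff]
  have hco := edgeExpansion_mul_sum_le G (fun v => g v ^ 2) (fun v => sq_nonneg (g v))
    (by rwa [hset])
  set D := ∑ u, ∑ v, G.adjMatrix ℝ u v * max (g u ^ 2 - g v ^ 2) 0 with hD
  set E := ∑ u, ∑ v, G.adjMatrix ℝ u v * (g u - g v) ^ 2 with hE
  have hN : 0 ≤ ∑ v, g v ^ 2 := Finset.sum_nonneg fun v _ => sq_nonneg (g v)
  have ha := adjMatrix_nonneg G
  have hE0 : 0 ≤ E := Finset.sum_nonneg fun u _ => Finset.sum_nonneg fun v _ =>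
    mul_nonneg (ha u v) (sq_nonneg _)
  have h2D : 2 * D = ∑ u, ∑ v, G.adjMatrix ℝ u v * |g u ^ 2 - g v ^ 2| := by
    rw [two_mul]
    nth_rewrite 2 [hD]
    rw [sum_adjMatrix_mul_comm, hD]
    simp only [← Finset.sum_add_distrib, ← mul_add]
    refine Finset.sum_congr rfl fun u _ => Finset.sum_congr rfl fun v _ => ?_
    congr 1
    rcases le_total (g u ^ 2) (g v ^ 2) with h | h
    · rw [max_eq_right (by linarith), max_eq_left (by linarith), abs_of_nonpos (by linarith)]
      ring
    · rw [max_eq_left (by linarith), max_eq_right (by linarith), abs_of_nonneg (by linarith)]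
      ring
  have hCS : (2 * D) ^ 2 ≤ E * ∑ u, ∑ v, G.adjMatrix ℝ u v * (g u + g v) ^ 2 := by
    rw [h2D, hE]
    simp only [← Fintype.sum_prod_type']
    refine Finset.sum_sq_le_sum_mul_sum_of_sq_le_mul _
      (fun p _ => mul_nonneg (ha _ _) (sq_nonneg _))
      (fun p _ => mul_nonneg (ha _ _) (sq_nonneg _)) (fun p _ => le_of_eq ?_)
    rw [mul_pow, sq_abs]
    ring
  have hF : ∑ u, ∑ v, G.adjMatrix ℝ u v * (g u + g v) ^ 2 ≤ 4 * (G.maxDegree * ∑ v, g v ^ 2) := by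
    calc ∑ u, ∑ v, G.adjMatrix ℝ u v * (g u + g v) ^ 2
        ≤ ∑ u, ∑ v, G.adjMatrix ℝ u v * (2 * g u ^ 2 + 2 * g v ^ 2) :=
          sum_adjMatrix_mul_le G fun u v => by nlinarith [sq_nonneg (g u - g v)]
      _ = 2 * ∑ u, ∑ v, G.adjMatrix ℝ u v * (2 * g u ^ 2) := by
          simp only [mul_add, Finset.sum_add_distrib]
          rw [two_mul, sum_adjMatrix_mul_comm G fun u v => 2 * g v ^ 2]
      _ = 4 * ∑ u, (G.degree u : ℝ) * g u ^ 2 := by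
          rw [sum_adjMatrix_mul_left G fun u => 2 * g u ^ 2]
          simp only [Finset.mul_sum]
          exact Finset.sum_congr rfl fun u _ => by ring
      _ ≤ 4 * (G.maxDegree * ∑ v, g v ^ 2) := by
          rw [Finset.mul_sum _ _ (G.maxDegree : ℝ)]
          gcongr with u
          exact G.degree_le_maxDegree u
  have hpow := pow_le_pow_left₀ (mul_nonneg (edgeExpansion_nonneg G) hN) hco 2
  nlinarith [mul_le_mul_of_nonneg_left hF hE0]

end Expansion

section LazyWalk

open Matrix

variable {V : Type*} [Fintype V] [DecidableEq V] (G : SimpleGraph V) [DecidableRel G.Adj]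

theorem lazyWalkMatrix_isHermitian : (lazyWalkMatrix G).IsHermitian := by
  ext u v
  rcases eq_or_ne u v with rfl | h
  · simp
  · simp [lazyWalkMatrix, G.adj_comm v u, h, h.symm]

theorem lazyWalkMatrix_mulVec (hΔ : 1 ≤ G.maxDegree) (y : V → ℝ) (u : V) :
    (lazyWalkMatrix G *ᵥ y) u =
      y u - (G.degree u * y u - ∑ v, G.adjMatrix ℝ u v * y v) / (2 * G.maxDegree) := by
  have hΔ' : (G.maxDegree : ℝ) ≠ 0 := by positivity
  have hentry (v : V) : lazyWalkMatrix G u v * y v =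
      (if u = v then (1 - G.degree u / (2 * G.maxDegree)) * y v else 0) +
        G.adjMatrix ℝ u v * y v / (2 * G.maxDegree) := by
    rcases eq_or_ne u v with rfl | h
    · simp [lazyWalkMatrix, SimpleGraph.adjMatrix_apply]
      left
      field_simp
      ring
    · by_cases huv : G.Adj u v
      · simp [lazyWalkMatrix, SimpleGraph.adjMatrix_apply, h, huv]
        ring
      · simp [lazyWalkMatrix, SimpleGraph.adjMatrix_apply, h, huv]
  rw [mulVec, dotProduct, Finset.sum_congr rfl fun v _ => hentry v, Finset.sum_add_distrib,
    ← Finset.sum_div, Finset.sum_ite_eq]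
  simp only [Finset.mem_univ, if_true]
  ring

theorem lazyWalkMatrix_mulVec_one (hΔ : 1 ≤ G.maxDegree) : lazyWalkMatrix G *ᵥ 1 = 1 := by
  ext u
  simp only [lazyWalkMatrix_mulVec G hΔ, Pi.one_apply, mul_one, sum_adjMatrix_apply,
    sub_self, zero_div, sub_zero]

/-- The Dirichlet form of the lazy random walk. -/
theorem sum_adjMatrix_mul_sub_mul_sub (hΔ : 1 ≤ G.maxDegree) (x y : V → ℝ) :
    ∑ u, ∑ v, G.adjMatrix ℝ u v * ((x u - x v) * (y u - y v)) =
      4 * G.maxDegree * (x ⬝ᵥ y - x ⬝ᵥ lazyWalkMatrix G *ᵥ y) := by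
  have hΔ' : (G.maxDegree : ℝ) ≠ 0 := by positivity
  have hsplit (u v : V) : G.adjMatrix ℝ u v * ((x u - x v) * (y u - y v)) =
      G.adjMatrix ℝ u v * (x u * y u - x u * y v) +
        G.adjMatrix ℝ u v * (x v * y v - x v * y u) := by ring
  simp only [hsplit, Finset.sum_add_distrib]
  rw [← sum_adjMatrix_mul_comm G fun u v => x u * y u - x u * y v, ← two_mul]
  simp only [mul_sub, Finset.sum_sub_distrib]
  rw [sum_adjMatrix_mul_left G fun u => x u * y u]
  simp only [dotProduct, lazyWalkMatrix_mulVec G hΔ, Finset.mul_sum, ← Finset.sum_sub_distrib]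
  refine Finset.sum_congr rfl fun u _ => ?_
  have h : ∑ v, 2 * (G.adjMatrix ℝ u v * (x u * y v)) =
      2 * x u * ∑ v, G.adjMatrix ℝ u v * y v := by
    rw [Finset.mul_sum]
    exact Finset.sum_congr rfl fun v _ => by ring
  rw [h]
  field_simp
  ring

theorem edgeExpansion_le_of_eigenvector (hΔ : 1 ≤ G.maxDegree) {f : V → ℝ} {m : ℝ}
    (hf : lazyWalkMatrix G *ᵥ f = m • f) (hpos : ∃ v, 0 < f v)
    (hcard : 2 * {v | 0 < f v}.ncard ≤ Fintype.card V) (hm : m ≤ 1) :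
    edgeExpansion G ≤ √(8 * (1 - m)) * G.maxDegree := by
  let g : V → ℝ := fun v => max (f v) 0
  have hset : {v | g v ≠ 0} = {v | 0 < f v} := by
    ext v
    simp [g]
  have hN : 0 < ∑ v, g v ^ 2 := by
    obtain ⟨v, hv⟩ := hpos
    refine Finset.sum_pos' (fun u _ => sq_nonneg _) ⟨v, Finset.mem_univ v, ?_⟩
    simp only [g, max_eq_left hv.le]
    positivity
  have hE : ∑ u, ∑ v, G.adjMatrix ℝ u v * (g u - g v) ^ 2 ≤
      4 * G.maxDegree * ((1 - m) * ∑ v, g v ^ 2) := by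
    calc ∑ u, ∑ v, G.adjMatrix ℝ u v * (g u - g v) ^ 2
        ≤ ∑ u, ∑ v, G.adjMatrix ℝ u v * ((g u - g v) * (f u - f v)) := by
          refine sum_adjMatrix_mul_le G fun u v => ?_
          simp only [g]
          rcases le_total (f u) 0 with hu | hu <;> rcases le_total (f v) 0 with hv | hv <;>
            simp only [hu, hv, max_eq_left, max_eq_right] <;> nlinarith
      _ = 4 * G.maxDegree * ((1 - m) * (g ⬝ᵥ f)) := by
          rw [sum_adjMatrix_mul_sub_mul_sub G hΔ, hf, dotProduct_smul, smul_eq_mul]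
          ring
      _ = 4 * G.maxDegree * ((1 - m) * ∑ v, g v ^ 2) := by
          congr 2
          refine Finset.sum_congr rfl fun v _ => ?_
          simp only [g]
          rcases le_total (f v) 0 with hv | hv <;> simp [hv, sq]
  have hmain := (edgeExpansion_mul_sum_sq_le G g (by rwa [hset])).trans
    (mul_le_mul_of_nonneg_left hE (by positivity))
  have hsq : edgeExpansion G ^ 2 ≤ 4 * (1 - m) * G.maxDegree ^ 2 :=
    le_of_mul_le_mul_right (by linarith) (pow_pos hN 2)
  refine abs_le_of_sq_le_sq' ?_ (by positivity) |>.2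
  rw [mul_pow, Real.sq_sqrt (by linarith)]
  nlinarith [mul_nonneg (sub_nonneg.mpr hm) (sq_nonneg (G.maxDegree : ℝ))]

theorem le_edgeExpansion_of_rayleigh (hn : 2 ≤ Fintype.card V) (hΔ : 1 ≤ G.maxDegree) {m : ℝ}
    (hm : m ≤ 1)
    (hray : ∀ x : V → ℝ, x ⬝ᵥ 1 = 0 → x ⬝ᵥ lazyWalkMatrix G *ᵥ x ≤ m * (x ⬝ᵥ x)) :
    (1 - m) * G.maxDegree ≤ edgeExpansion G := by
  have hV : Nonempty V := Fintype.card_pos_iff.mp (by omega)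
  refine le_csInf ⟨_, {hV.some}, Set.singleton_nonempty _, by simpa using hn, rfl⟩ ?_
  rintro r ⟨S, hS, hcard, rfl⟩
  have hs : (0 : ℝ) < S.ncard := by exact_mod_cast (Set.ncard_pos).mpr hS
  have hn' : (0 : ℝ) < Fintype.card V := by exact_mod_cast Fintype.card_pos
  have hcard' : (2 : ℝ) * S.ncard ≤ Fintype.card V := by exact_mod_cast hcard
  rw [le_div_iff₀ hs]
  let ind : V → ℝ := fun v => if v ∈ S then 1 else 0
  let c : ℝ := S.ncard / Fintype.card V
  let x : V → ℝ := fun v => ind v - c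
  have hc : c ≤ 1 / 2 := by
    rw [div_le_div_iff₀ hn' two_pos]
    linarith
  have hcn : Fintype.card V * c = S.ncard := by simp only [c]; field_simp
  have hind : ∑ v, ind v = S.ncard := by
    rw [Set.ncard_eq_toFinset_card']
    simp [ind]
  have hx1 : x ⬝ᵥ 1 = 0 := by
    simp [x, dotProduct, hind, hcn]
  have hxx : x ⬝ᵥ x = S.ncard * (1 - c) := by
    have hpt (v : V) : x v * x v = ind v * (1 - 2 * c) + c * c := by
      by_cases hv : v ∈ S
      · simp only [x, ind, hv, if_true]; ring
      · simp only [x, ind, hv, if_false]; ring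
    simp only [dotProduct, hpt, Finset.sum_add_distrib, ← Finset.sum_mul, hind, Finset.sum_const,
      Finset.card_univ, nsmul_eq_mul]
    rw [hcn]
    ring
  have hcut : ∑ u, ∑ v, G.adjMatrix ℝ u v * ((x u - x v) * (x u - x v)) = 2 * cutCard G S := by
    rw [two_mul, cutCard_eq_sum]
    nth_rewrite 2 [sum_adjMatrix_mul_comm]
    simp only [← Finset.sum_add_distrib, ← mul_add]
    refine Finset.sum_congr rfl fun u _ => Finset.sum_congr rfl fun v _ => ?_
    congr 1
    by_cases hu : u ∈ S <;> by_cases hv : v ∈ S <;> simp [x, ind, hu, hv]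
    ring
  rw [sum_adjMatrix_mul_sub_mul_sub G hΔ] at hcut
  have h1 : (1 - m) * (S.ncard * (1 - c)) ≤ x ⬝ᵥ x - x ⬝ᵥ lazyWalkMatrix G *ᵥ x := by
    have := hray x hx1
    rw [← hxx]
    linarith
  have h2 : (1 - m) * (S.ncard * (1 / 2)) ≤ (1 - m) * (S.ncard * (1 - c)) := by
    refine mul_le_mul_of_nonneg_left (mul_le_mul_of_nonneg_left ?_ hs.le) (by linarith)
    linarith
  have h3 := mul_le_mul_of_nonneg_left (h2.trans h1) (show (0 : ℝ) ≤ 4 * G.maxDegree by positivity)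
  linarith

end LazyWalk

/-- Let `G` be a finite simple graph on `n ≥ 2` vertices with
maximum degree `Δ ≥ 1`, let `P` be its lazy random-walk matrix, and let `λ₂ = μ 1`
be the second largest eigenvalue of `P`, where `μ` lists the eigenvalues of `P`
in nonincreasing order with multiplicities (i.e. the characteristic polynomial of
`P` is `∏ i, (X - μ i)`). If `0 ≤ λ₂ < 1`, then
`(1 - λ₂)·Δ ≤ h(G) ≤ √(8·(1 - λ₂))·Δ`. -/
theorem expansion_eigenvalue_bounds {V : Type*} [Fintype V] [DecidableEq V]
    (G : SimpleGraph V) [DecidableRel G.Adj]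
    (hn : 2 ≤ Fintype.card V) (hΔ : 1 ≤ G.maxDegree)
    (μ : Fin (Fintype.card V) → ℝ) (hanti : Antitone μ)
    (hchar : (lazyWalkMatrix G).charpoly =
      ∏ i : Fin (Fintype.card V), (Polynomial.X - Polynomial.C (μ i)))
    (hmu0 : 0 ≤ μ ⟨1, by omega⟩) (hmu1 : μ ⟨1, by omega⟩ < 1) :
    (1 - μ ⟨1, by omega⟩) * (G.maxDegree : ℝ) ≤ edgeExpansion G ∧
    edgeExpansion G ≤ Real.sqrt (8 * (1 - μ ⟨1, by omega⟩)) * (G.maxDegree : ℝ) := by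
  obtain ⟨b, hb⟩ := (lazyWalkMatrix_isHermitian G).exists_eigenbasis_of_charpoly_eq hanti hchar
  set i₀ : Fin (Fintype.card V) := ⟨0, by omega⟩
  set i₁ : Fin (Fintype.card V) := ⟨1, by omega⟩
  have hV : Nonempty V := Fintype.card_pos_iff.mp (by omega)
  have hone : Matrix.mulVec (lazyWalkMatrix G) 1 = (1 : ℝ) • (1 : V → ℝ) := by
    rw [lazyWalkMatrix_mulVec_one G hΔ, one_smul]
  refine ⟨le_edgeExpansion_of_rayleigh G hn hΔ hmu1.le fun x hx =>
    (lazyWalkMatrix_isHermitian G).dotProduct_mulVec_le_of_orthogonal b hb (i₀ := i₀)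
      (fun i hi => hanti ?_) one_ne_zero hone hmu1 hx, ?_⟩
  · rw [Fin.le_def]
    exact Nat.one_le_iff_ne_zero.mpr fun h => hi (Fin.ext h)
  have hf := hb i₁
  set f : V → ℝ := (b i₁).ofLp
  have hf0 : f ≠ 0 := fun h => b.orthonormal.ne_zero i₁ (by ext v; exact congrFun h v)
  have hsum : ∑ v, f v = 0 := by
    simpa [dotProduct] using
      (lazyWalkMatrix_isHermitian G).dotProduct_eq_zero_of_eigenvalue_ne hf hone hmu1.ne
  obtain ⟨v, hv⟩ := Function.ne_iff.mp hf0
  have hpos : ∃ v, 0 < f v := by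
    by_contra! h
    exact hv ((Finset.sum_eq_zero_iff_of_nonpos fun u _ => h u).mp hsum v (Finset.mem_univ v))
  have hneg : ∃ v, 0 < (-f) v := by
    by_contra! h
    refine hv ((Finset.sum_eq_zero_iff_of_nonneg fun u _ => ?_).mp hsum v (Finset.mem_univ v))
    simpa using h u
  have hdisj : Disjoint {v | 0 < f v} {v | 0 < (-f) v} := by
    rw [Set.disjoint_left]
    intro u hu hu'
    simp only [Set.mem_ofPred_eq, Pi.neg_apply] at hu hu'
    linarith
  have hcard : {v | 0 < f v}.ncard + {v | 0 < (-f) v}.ncard ≤ Fintype.card V := by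
    rw [← Set.ncard_union_eq hdisj, ← Nat.card_eq_fintype_card]
    exact Set.ncard_le_card _
  rcases le_total {v | 0 < f v}.ncard {v | 0 < (-f) v}.ncard with h | h
  · exact edgeExpansion_le_of_eigenvector G hΔ hf hpos (by omega) hmu1.le
  · refine edgeExpansion_le_of_eigenvector G hΔ (f := -f) ?_ hneg (by omega) hmu1.le
    rw [Matrix.mulVec_neg, hf, smul_neg]
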